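/- Let p1, p2 be probability mass functions on {0,1}×𝒴1 and {0,1}×𝒴2 respectively, let q be their combined distribution, and let α∈(0,1)∪(1,2]∪[3,∞). Let a1,a2∈[0,1/2] satisfy h_α(a_i) = H^H_α(X_i|Y_i)_{p_i} for i=1,2. Then H^H_α(X_1⊕X_2|Y_1Y_2)_q ≥ h_α(a1(1−a2)+a2(1−a1)). For α∈[2,3] the same holds with ≥ replaced by ≤, and for α∈{2,3} it holds with equality. -/

import Mathlib

open Finset

/-- `p` is a probability mass function on a finite type. -/
def IsPMF {Ω : Type*} [Fintype Ω] (p : Ω → ℝ) : Prop :=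
  (∀ ω, 0 ≤ p ω) ∧ ∑ ω, p ω = 1

/-- Marginal distribution of the second component. -/
noncomputable def margY {X Y : Type*} [Fintype X] (p : X × Y → ℝ) (y : Y) : ℝ := ∑ x, p (x, y)

/-- Conditional distribution `p(x|y)`. -/
noncomputable def condXY {X Y : Type*} [Fintype X] (p : X × Y → ℝ) (x : X) (y : Y) : ℝ :=
  p (x, y) / margY p y

/-- Hayashi conditional Rényi entropy `H^H_α(X|Y)_p`. -/
noncomputable def HH {X Y : Type*} [Fintype X] [Fintype Y] (α : ℝ) (p : X × Y → ℝ) : ℝ :=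
  (1 / (1 - α)) * Real.log (∑ y, margY p y * ∑ x, condXY p x y ^ α)

/-- Arimoto conditional Rényi entropy `H^A_α(X|Y)_p`. -/
noncomputable def HA {X Y : Type*} [Fintype X] [Fintype Y] (α : ℝ) (p : X × Y → ℝ) : ℝ :=
  (α / (1 - α)) * Real.log (∑ y, margY p y * (∑ x, condXY p x y ^ α) ^ (1 / α))

/-- The tilted probability mass function `p̄`. -/
noncomputable def tilt {X Y : Type*} [Fintype X] [Fintype Y] (α : ℝ) (p : X × Y → ℝ) :
    X × Y → ℝ := fun (x, y) =>
  condXY p x y ^ α * margY p y / ∑ xy : X × Y, condXY p xy.1 xy.2 ^ α * margY p xy.2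

variable {Y1 Y2 : Type*} [Fintype Y1] [Fintype Y2]

/-- The joint distribution of `Z = X₁ ⊕ X₂` and the side information `(Y₁, Y₂)` under the
combined distribution `q(z,x₂,y₁,y₂) = p₁(z ⊕ x₂, y₁) p₂(x₂, y₂)`. -/
noncomputable def combinedZ (p1 : ZMod 2 × Y1 → ℝ) (p2 : ZMod 2 × Y2 → ℝ) :
    ZMod 2 × (Y1 × Y2) → ℝ := fun zy => ∑ x2 : ZMod 2, p1 (zy.1 + x2, zy.2.1) * p2 (x2, zy.2.2)

/-- The joint distribution of `X₂` and `(Z = X₁ ⊕ X₂, Y₁, Y₂)` under the combined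
distribution `q(z,x₂,y₁,y₂) = p₁(z ⊕ x₂, y₁) p₂(x₂, y₂)`. -/
noncomputable def combinedX2 (p1 : ZMod 2 × Y1 → ℝ) (p2 : ZMod 2 × Y2 → ℝ) :
    ZMod 2 × (ZMod 2 × Y1 × Y2) → ℝ := fun xw =>
  p1 (xw.2.1 + xw.1, xw.2.2.1) * p2 (xw.1, xw.2.2.2)


/-- Binary Rényi entropy `h_α(t)`. -/
noncomputable def binEnt (α : ℝ) (t : ℝ) : ℝ :=
  (1 / (1 - α)) * Real.log (t ^ α + (1 - t) ^ α)

/-- The sum `(1 + u)^α + (1 - u)^α`, which is `2^α` times the power sum of a binary distribution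
with bias `u`. -/
noncomputable def biasSum (α u : ℝ) : ℝ := (1 + u) ^ α + (1 - u) ^ α

/-- The difference `(1 + u)^β - (1 - u)^β`. -/
noncomputable def biasDiff (β u : ℝ) : ℝ := (1 + u) ^ β - (1 - u) ^ β

/-- The elasticity `u D'(u) / D(u)` of `D = biasDiff β`. -/
noncomputable def biasElasticity (β u : ℝ) : ℝ :=
  u * (β * biasSum (β - 1) u) / biasDiff β u

lemma biasSum_neg (α u : ℝ) : biasSum α (-u) = biasSum α u := by
  simp only [biasSum, sub_neg_eq_add, ← sub_eq_add_neg]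
  ring

lemma biasSum_abs (α u : ℝ) : biasSum α |u| = biasSum α u := by
  rcases abs_choice u with h | h <;> rw [h]
  exact biasSum_neg α u

lemma biasSum_pos (α : ℝ) {u : ℝ} (h0 : 0 ≤ u) (h1 : u ≤ 1) : 0 < biasSum α u :=
  add_pos_of_pos_of_nonneg (Real.rpow_pos_of_pos (by linarith) α)
    (Real.rpow_nonneg (by linarith) α)

lemma continuous_biasSum {α : ℝ} (hα : 0 < α) : Continuous (biasSum α) := by
  unfold biasSum
  exact ((continuous_const.add continuous_id).rpow_const fun _ => Or.inr hα.le).add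
    ((continuous_const.sub continuous_id).rpow_const fun _ => Or.inr hα.le)

lemma hasDerivAt_one_add_rpow (β : ℝ) {u : ℝ} (h0 : 0 ≤ u) :
    HasDerivAt (fun u : ℝ => (1 + u) ^ β) (β * (1 + u) ^ (β - 1)) u := by
  have h : HasDerivAt (fun u : ℝ => 1 + u) 1 u := (hasDerivAt_id u).const_add 1
  simpa using h.rpow_const (p := β) (Or.inl (by linarith))

lemma hasDerivAt_one_sub_rpow (β : ℝ) {u : ℝ} (h1 : u < 1) :
    HasDerivAt (fun u : ℝ => (1 - u) ^ β) (-(β * (1 - u) ^ (β - 1))) u := by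
  have h : HasDerivAt (fun u : ℝ => 1 - u) (-1) u := (hasDerivAt_id u).const_sub 1
  simpa using h.rpow_const (p := β) (Or.inl (by linarith))

lemma hasDerivAt_biasSum (α : ℝ) {u : ℝ} (h0 : 0 ≤ u) (h1 : u < 1) :
    HasDerivAt (biasSum α) (α * biasDiff (α - 1) u) u := by
  have h := (hasDerivAt_one_add_rpow α h0).add (hasDerivAt_one_sub_rpow α h1)
  exact h.congr_deriv (by unfold biasDiff; ring)

lemma hasDerivAt_biasDiff (β : ℝ) {u : ℝ} (h0 : 0 ≤ u) (h1 : u < 1) :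
    HasDerivAt (biasDiff β) (β * biasSum (β - 1) u) u := by
  have h := (hasDerivAt_one_add_rpow β h0).sub (hasDerivAt_one_sub_rpow β h1)
  exact h.congr_deriv (by unfold biasSum; ring)

lemma mul_biasDiff_pos {β u : ℝ} (hβ : β ≠ 0) (h0 : 0 < u) (h1 : u < 1) :
    0 < β * biasDiff β u := by
  unfold biasDiff
  rcases lt_or_gt_of_ne hβ with h | h
  · have := Real.rpow_lt_rpow_of_neg (x := 1 - u) (y := 1 + u) (by linarith) (by linarith) h
    exact mul_pos_of_neg_of_neg h (by linarith)
  · have := Real.rpow_lt_rpow (x := 1 - u) (y := 1 + u) (by linarith) (by linarith) h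
    exact mul_pos h (by linarith)

lemma biasDiff_ne_zero {β u : ℝ} (hβ : β ≠ 0) (h0 : 0 < u) (h1 : u < 1) :
    biasDiff β u ≠ 0 :=
  right_ne_zero_of_mul (mul_biasDiff_pos hβ h0 h1).ne'

lemma biasDiff_mul_biasDiff_pos {β u v : ℝ} (hβ : β ≠ 0) (hu0 : 0 < u) (hu1 : u < 1)
    (hv0 : 0 < v) (hv1 : v < 1) : 0 < biasDiff β u * biasDiff β v := by
  have h := mul_pos (mul_biasDiff_pos hβ hu0 hu1) (mul_biasDiff_pos hβ hv0 hv1)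
  have h2 : 0 < (β * β) * (biasDiff β u * biasDiff β v) := by linarith
  exact pos_of_mul_pos_right h2 (mul_self_nonneg β)

lemma mul_sinh_sub_nonneg {c γ θ : ℝ} (hc : 0 ≤ c * γ * (|γ| - 1)) (hθ : 0 ≤ θ) :
    0 ≤ c * (Real.sinh (γ * θ) - γ * Real.sinh θ) := by
  have hd : ∀ t : ℝ, HasDerivAt (fun t => c * (Real.sinh (γ * t) - γ * Real.sinh t))
      (c * (Real.cosh (γ * t) * γ - γ * Real.cosh t)) t := fun t => by
    have h1 : HasDerivAt (fun t : ℝ => γ * t) γ t := by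
      simpa using (hasDerivAt_id t).const_mul γ
    exact (h1.sinh.sub ((Real.hasDerivAt_sinh t).const_mul γ)).const_mul c
  have hmono : MonotoneOn (fun t => c * (Real.sinh (γ * t) - γ * Real.sinh t)) (Set.Ici 0) := by
    refine monotoneOn_of_deriv_nonneg (convex_Ici 0)
      (fun t _ => (hd t).continuousAt.continuousWithinAt)
      (fun t _ => (hd t).differentiableAt.differentiableWithinAt) fun t _ => ?_
    rw [(hd t).deriv]
    have e : c * (Real.cosh (γ * t) * γ - γ * Real.cosh t)
        = c * γ * (Real.cosh (γ * t) - Real.cosh t) := by ring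
    rw [e]
    rcases lt_trichotomy |γ| 1 with h | h | h
    · have h1 : c * γ ≤ 0 := by nlinarith
      have h2 : Real.cosh (γ * t) ≤ Real.cosh t := by
        rw [Real.cosh_le_cosh, abs_mul]
        nlinarith [abs_nonneg t]
      exact mul_nonneg_of_nonpos_of_nonpos h1 (by linarith)
    · have h2 : Real.cosh (γ * t) = Real.cosh t := by
        rw [← Real.cosh_abs, abs_mul, h, one_mul, Real.cosh_abs]
      simp [h2]
    · have h1 : 0 ≤ c * γ := by nlinarith
      have h2 : Real.cosh t ≤ Real.cosh (γ * t) := by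
        rw [Real.cosh_le_cosh, abs_mul]
        nlinarith [abs_nonneg t]
      exact mul_nonneg h1 (by linarith)
  simpa using hmono (Set.mem_Ici.2 le_rfl) (Set.mem_Ici.2 hθ) hθ

lemma mul_rpow_sq_sub_nonneg {c γ u : ℝ} (hc : 0 ≤ c * γ * (|γ| - 1)) (h0 : 0 ≤ u) (h1 : u < 1) :
    0 ≤ c * (((1 + u) ^ γ) ^ 2 - ((1 - u) ^ γ) ^ 2
      - 4 * γ * u * ((1 + u) ^ γ * (1 - u) ^ γ) / ((1 + u) * (1 - u))) := by
  have hx : 0 < 1 + u := by linarith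
  have hy : 0 < 1 - u := by linarith
  have hA := Real.rpow_pos_of_pos hx γ
  have hB := Real.rpow_pos_of_pos hy γ
  set θ := Real.log (1 + u) - Real.log (1 - u) with hθ
  have hθ0 : 0 ≤ θ := sub_nonneg.2 (Real.log_le_log hy (by linarith))
  have key := mul_sinh_sub_nonneg hc hθ0
  have e1 : Real.exp θ = (1 + u) / (1 - u) := by
    rw [hθ, Real.exp_sub, Real.exp_log hx, Real.exp_log hy]
  have e2 : Real.exp (γ * θ) = (1 + u) ^ γ / (1 - u) ^ γ := by
    rw [hθ, mul_sub, Real.exp_sub, Real.rpow_def_of_pos hx, Real.rpow_def_of_pos hy,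
      mul_comm γ, mul_comm γ]
  rw [Real.sinh_eq, Real.sinh_eq, Real.exp_neg, Real.exp_neg, e1, e2] at key
  have h2 := mul_nonneg key (mul_pos two_pos (mul_pos hA hB)).le
  refine h2.trans_eq ?_
  field_simp
  ring

lemma mul_biasElasticity_monotoneOn {c β : ℝ} (hβ : β ≠ 0)
    (hc : 0 ≤ c * β * (β - 1) * (|β - 1| - 1)) :
    MonotoneOn (fun u => c * biasElasticity β u) (Set.Ioo 0 1) := by
  have hd : ∀ u ∈ Set.Ioo (0:ℝ) 1, HasDerivAt (fun u => c * biasElasticity β u)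
      (c * (((1 * (β * biasSum (β - 1) u) + u * (β * ((β - 1) * biasDiff (β - 1 - 1) u)))
        * biasDiff β u - u * (β * biasSum (β - 1) u) * (β * biasSum (β - 1) u))
        / biasDiff β u ^ 2)) u := fun u hu =>
    (((hasDerivAt_id u).mul ((hasDerivAt_biasSum (β - 1) hu.1.le hu.2).const_mul β)).div
      (hasDerivAt_biasDiff β hu.1.le hu.2) (biasDiff_ne_zero hβ hu.1 hu.2)).const_mul c
  refine monotoneOn_of_deriv_nonneg (convex_Ioo 0 1)
      (fun t ht => (hd t ht).continuousAt.continuousWithinAt)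
      (fun t ht => (hd t (interior_subset ht)).differentiableAt.differentiableWithinAt)
      fun u hu => ?_
  replace hu := interior_subset hu
  rw [(hd u hu).deriv, ← mul_div_assoc]
  refine div_nonneg ?_ (sq_nonneg _)
  have hx : 0 < 1 + u := by linarith [hu.1]
  have hy : 0 < 1 - u := by linarith [hu.2]
  have key := mul_rpow_sq_sub_nonneg (c := c * β) (γ := β - 1) (by linarith) hu.1.le hu.2
  refine key.trans_eq ?_
  have ex : (1 + u) ^ β = (1 + u) ^ (β - 1) * (1 + u) := by
    rw [← Real.rpow_add_one hx.ne', sub_add_cancel]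
  have ey : (1 - u) ^ β = (1 - u) ^ (β - 1) * (1 - u) := by
    rw [← Real.rpow_add_one hy.ne', sub_add_cancel]
  unfold biasSum biasDiff
  rw [ex, ey, Real.rpow_sub_one hx.ne' (β - 1), Real.rpow_sub_one hy.ne' (β - 1)]
  field_simp
  ring

lemma mul_biasDiff_ratio_antitoneOn {c β v : ℝ} (hβ : β ≠ 0)
    (hc : 0 ≤ c * β * (β - 1) * (|β - 1| - 1)) (hv0 : 0 < v) (hv1 : v ≤ 1) :
    AntitoneOn (fun u => c * (biasDiff β (v * u) / biasDiff β u)) (Set.Ioo 0 1) := by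
  have hvu : ∀ u ∈ Set.Ioo (0:ℝ) 1, v * u ∈ Set.Ioo (0:ℝ) 1 := fun u hu =>
    ⟨mul_pos hv0 hu.1, by nlinarith [hu.1, hu.2]⟩
  have hd : ∀ u ∈ Set.Ioo (0:ℝ) 1, HasDerivAt (fun u => c * (biasDiff β (v * u) / biasDiff β u))
      (c * ((β * biasSum (β - 1) (v * u) * v * biasDiff β u
        - biasDiff β (v * u) * (β * biasSum (β - 1) u)) / biasDiff β u ^ 2)) u := fun u hu => by
    have h1 : HasDerivAt (fun u : ℝ => v * u) v u := by
      simpa using (hasDerivAt_id u).const_mul v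
    exact (((hasDerivAt_biasDiff β (hvu u hu).1.le (hvu u hu).2).comp u h1).div
      (hasDerivAt_biasDiff β hu.1.le hu.2) (biasDiff_ne_zero hβ hu.1 hu.2)).const_mul c
  refine antitoneOn_of_deriv_nonpos (convex_Ioo 0 1)
      (fun t ht => (hd t ht).continuousAt.continuousWithinAt)
      (fun t ht => (hd t (interior_subset ht)).differentiableAt.differentiableWithinAt)
      fun u hu => ?_
  replace hu := interior_subset hu
  rw [(hd u hu).deriv, ← mul_div_assoc]
  refine div_nonpos_of_nonpos_of_nonneg ?_ (sq_nonneg _)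
  have hm := mul_biasElasticity_monotoneOn hβ hc (hvu u hu) hu (by nlinarith [hu.1])
  have hpos := biasDiff_mul_biasDiff_pos hβ (hvu u hu).1 (hvu u hu).2 hu.1 hu.2
  have n1 := biasDiff_ne_zero hβ (hvu u hu).1 (hvu u hu).2
  have n2 := biasDiff_ne_zero hβ hu.1 hu.2
  have h := mul_le_mul_of_nonneg_right hm hpos.le
  have h3 : u * (c * (β * biasSum (β - 1) (v * u) * v * biasDiff β u
        - biasDiff β (v * u) * (β * biasSum (β - 1) u)))
      = c * biasElasticity β (v * u) * (biasDiff β (v * u) * biasDiff β u)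
        - c * biasElasticity β u * (biasDiff β (v * u) * biasDiff β u) := by
    unfold biasElasticity
    generalize biasDiff β (v * u) = D at n1 ⊢
    field_simp
  by_contra! hcon
  have := mul_pos hu.1 hcon
  linarith

lemma sum_mul_eq_of_extremal {ι : Type*} [Fintype ι] {w u : ι → ℝ} {f g : ℝ → ℝ} {u₀ : ℝ}
    (hw : ∀ i, 0 ≤ w i) (hw1 : ∑ i, w i = 1)
    (hext : ∀ i, f u₀ ≤ f (u i)) (hinj : ∀ i, f (u i) = f u₀ → u i = u₀)
    (hf : f u₀ = ∑ i, w i * f (u i)) : ∑ i, w i * g (u i) = g u₀ := by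
  have h0 : ∑ i, w i * (f (u i) - f u₀) = 0 := by
    simp only [mul_sub, Finset.sum_sub_distrib, ← Finset.sum_mul, hw1, ← hf]
    ring
  have h1 := (Finset.sum_eq_zero_iff_of_nonneg
    (fun i _ => mul_nonneg (hw i) (sub_nonneg.2 (hext i)))).1 h0
  have h2 : ∀ i, w i * g (u i) = w i * g u₀ := fun i => by
    rcases mul_eq_zero.1 (h1 i (Finset.mem_univ i)) with h | h
    · simp [h]
    · rw [hinj i (by linarith)]
  rw [Finset.sum_congr rfl fun i _ => h2 i, ← Finset.sum_mul, hw1, one_mul]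

/-- Jensen's inequality for `g ∘ f⁻¹` when `g' / f'` is antitone. -/
lemma sum_mul_le_of_deriv_ratio_antitone {ι : Type*} [Fintype ι] {w u : ι → ℝ}
    {f g f' g' : ℝ → ℝ} {u₀ : ℝ}
    (hw : ∀ i, 0 ≤ w i) (hw1 : ∑ i, w i = 1) (hu : ∀ i, u i ∈ Set.Icc (0:ℝ) 1)
    (hu₀ : u₀ ∈ Set.Icc (0:ℝ) 1)
    (hfc : ContinuousOn f (Set.Icc 0 1)) (hgc : ContinuousOn g (Set.Icc 0 1))
    (hfd : ∀ x ∈ Set.Ioo (0:ℝ) 1, HasDerivAt f (f' x) x)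
    (hgd : ∀ x ∈ Set.Ioo (0:ℝ) 1, HasDerivAt g (g' x) x)
    (hpos : ∀ x ∈ Set.Ioo (0:ℝ) 1, 0 < f' x)
    (hanti : AntitoneOn (fun x => g' x / f' x) (Set.Ioo 0 1))
    (hf : f u₀ = ∑ i, w i * f (u i)) : ∑ i, w i * g (u i) ≤ g u₀ := by
  have hmono : StrictMonoOn f (Set.Icc 0 1) := by
    refine strictMonoOn_of_deriv_pos (convex_Icc 0 1) hfc fun x hx => ?_
    rw [interior_Icc] at hx
    rw [(hfd x hx).deriv]
    exact hpos x hx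
  have hinj : ∀ i, f (u i) = f u₀ → u i = u₀ := fun i h => hmono.injOn (hu i) hu₀ h
  rcases eq_or_lt_of_le hu₀.1 with h | h0
  · exact (sum_mul_eq_of_extremal hw hw1
      (fun i => hmono.monotoneOn hu₀ (hu i) (h ▸ (hu i).1)) hinj hf).le
  rcases eq_or_lt_of_le hu₀.2 with h | h1
  · refine (sum_mul_eq_of_extremal (f := fun x => -f x) hw hw1
      (fun i => neg_le_neg (hmono.monotoneOn (hu i) hu₀ (h ▸ (hu i).2)))
      (fun i hi => hinj i (neg_injective hi)) ?_).le
    simp [hf]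
  have hm : u₀ ∈ Set.Ioo (0:ℝ) 1 := ⟨h0, h1⟩
  set c := g' u₀ / f' u₀ with hc
  have hGd : ∀ x ∈ Set.Ioo (0:ℝ) 1, HasDerivAt (fun x => g x - c * f x) (g' x - c * f' x) x :=
    fun x hx => (hgd x hx).sub ((hfd x hx).const_mul c)
  have hGc : ContinuousOn (fun x => g x - c * f x) (Set.Icc 0 1) :=
    hgc.sub (continuousOn_const.mul hfc)
  have hG1 : MonotoneOn (fun x => g x - c * f x) (Set.Icc 0 u₀) := by
    refine monotoneOn_of_deriv_nonneg (convex_Icc 0 u₀)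
      (hGc.mono (Set.Icc_subset_Icc le_rfl h1.le)) ?_ ?_ <;> rw [interior_Icc]
    · exact fun x hx => (hGd x ⟨hx.1, hx.2.trans h1⟩).differentiableAt.differentiableWithinAt
    · intro x hx
      have hx' : x ∈ Set.Ioo (0:ℝ) 1 := ⟨hx.1, hx.2.trans h1⟩
      rw [(hGd x hx').deriv, sub_nonneg, ← le_div_iff₀ (hpos x hx')]
      exact hanti hx' hm hx.2.le
  have hG2 : AntitoneOn (fun x => g x - c * f x) (Set.Icc u₀ 1) := by
    refine antitoneOn_of_deriv_nonpos (convex_Icc u₀ 1)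
      (hGc.mono (Set.Icc_subset_Icc h0.le le_rfl)) ?_ ?_ <;> rw [interior_Icc]
    · exact fun x hx => (hGd x ⟨h0.trans hx.1, hx.2⟩).differentiableAt.differentiableWithinAt
    · intro x hx
      have hx' : x ∈ Set.Ioo (0:ℝ) 1 := ⟨h0.trans hx.1, hx.2⟩
      rw [(hGd x hx').deriv, sub_nonpos, ← div_le_iff₀ (hpos x hx')]
      exact hanti hm hx' hx.1.le
  have hmax : ∀ i, w i * (g (u i) - c * f (u i)) ≤ w i * (g u₀ - c * f u₀) := fun i => by
    refine mul_le_mul_of_nonneg_left ?_ (hw i)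
    rcases le_total (u i) u₀ with h | h
    · exact hG1 ⟨(hu i).1, h⟩ ⟨h0.le, le_rfl⟩ h
    · exact hG2 ⟨le_rfl, h1.le⟩ ⟨h, (hu i).2⟩ h
  have hs := Finset.sum_le_sum fun i (_ : i ∈ Finset.univ) => hmax i
  rw [← Finset.sum_mul, hw1] at hs
  have e : ∑ i, w i * (g (u i) - c * f (u i))
      = ∑ i, w i * g (u i) - c * ∑ i, w i * f (u i) := by
    rw [Finset.mul_sum, ← Finset.sum_sub_distrib]
    exact Finset.sum_congr rfl fun i _ => by ring
  rw [e, ← hf] at hs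
  linarith

lemma mul_sum_biasSum_le {ι : Type*} [Fintype ι] {w u : ι → ℝ} {c α u₀ v : ℝ}
    (hα0 : 0 < α) (hα1 : α ≠ 1)
    (hc : 0 ≤ c * (α - 1) * (α - 1 - 1) * (|α - 1 - 1| - 1))
    (hw : ∀ i, 0 ≤ w i) (hw1 : ∑ i, w i = 1) (hu : ∀ i, |u i| ≤ 1)
    (hu₀ : u₀ ∈ Set.Icc (0:ℝ) 1) (hv : |v| ≤ 1)
    (h : biasSum α u₀ = ∑ i, w i * biasSum α (u i)) :
    c * (α - 1) * ∑ i, w i * biasSum α (v * u i) ≤ c * (α - 1) * biasSum α (v * u₀) := by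
  have hβ : α - 1 ≠ 0 := sub_ne_zero.2 hα1
  rcases (abs_nonneg v).eq_or_lt with hv0 | hv0
  · have : v = 0 := abs_eq_zero.1 hv0.symm
    simp [this, ← Finset.sum_mul, hw1]
  have habs : ∀ i, biasSum α (v * u i) = biasSum α (|v| * |u i|) := fun i => by
    rw [← abs_mul, biasSum_abs]
  have habs0 : biasSum α (v * u₀) = biasSum α (|v| * u₀) := by
    rw [← biasSum_abs, abs_mul, abs_of_nonneg hu₀.1]
  simp only [habs, habs0]
  have h' : biasSum α u₀ = ∑ i, w i * biasSum α |u i| := by simp only [biasSum_abs, h]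
  have hcont := continuous_biasSum hα0
  have hvx : ∀ x ∈ Set.Ioo (0:ℝ) 1, |v| * x ∈ Set.Ioo (0:ℝ) 1 := fun x hx =>
    ⟨mul_pos hv0 hx.1, by nlinarith [hx.1, hx.2]⟩
  have key := sum_mul_le_of_deriv_ratio_antitone (w := w) (u := fun i => |u i|)
    (f := fun x => (α - 1) * biasSum α x)
    (g := fun x => c * (α - 1) * biasSum α (|v| * x))
    (f' := fun x => (α - 1) * (α * biasDiff (α - 1) x))
    (g' := fun x => c * (α - 1) * (α * biasDiff (α - 1) (|v| * x) * |v|)) (u₀ := u₀)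
    hw hw1 (fun i => ⟨abs_nonneg _, hu i⟩) hu₀
    (by fun_prop) (by fun_prop)
    (fun x hx => (hasDerivAt_biasSum α hx.1.le hx.2).const_mul _)
    (fun x hx => by
      have h1 : HasDerivAt (fun x : ℝ => |v| * x) |v| x := by
        simpa using (hasDerivAt_id x).const_mul |v|
      exact ((hasDerivAt_biasSum α (hvx x hx).1.le (hvx x hx).2).comp x h1).const_mul _)
    (fun x hx => by
      have := mul_pos hα0 (mul_biasDiff_pos hβ hx.1 hx.2)
      linarith)
    (fun x hx y hy hxy => by
      have h1 := mul_le_mul_of_nonneg_left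
        (mul_biasDiff_ratio_antitoneOn hβ hc hv0 hv hx hy hxy) hv0.le
      have nx := biasDiff_ne_zero hβ hx.1 hx.2
      have ny := biasDiff_ne_zero hβ hy.1 hy.2
      convert h1 using 1 <;> field_simp)
    (by
      rw [h', Finset.mul_sum]
      exact Finset.sum_congr rfl fun i _ => by ring)
  refine le_trans (le_of_eq ?_) key
  rw [Finset.mul_sum]
  exact Finset.sum_congr rfl fun i _ => by ring

/-- The conditional bias `p(0|y) - p(1|y)`. -/
noncomputable def condBias {Y : Type*} (p : ZMod 2 × Y → ℝ) (y : Y) : ℝ :=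
  (p (0, y) - p (1, y)) / margY p y

lemma margY_zmod_two {Y : Type*} (p : ZMod 2 × Y → ℝ) (y : Y) :
    margY p y = p (0, y) + p (1, y) :=
  Fin.sum_univ_two _

lemma margY_nonneg {Y : Type*} {p : ZMod 2 × Y → ℝ} (hp : ∀ xy, 0 ≤ p xy) (y : Y) :
    0 ≤ margY p y :=
  Finset.sum_nonneg fun _ _ => hp _

lemma sum_margY {Y : Type*} [Fintype Y] {p : ZMod 2 × Y → ℝ} (hp : IsPMF p) :
    ∑ y, margY p y = 1 := by
  rw [← hp.2, Fintype.sum_prod_type_right]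
  rfl

lemma abs_condBias_le_one {Y : Type*} {p : ZMod 2 × Y → ℝ} (hp : ∀ xy, 0 ≤ p xy) (y : Y) :
    |condBias p y| ≤ 1 := by
  unfold condBias
  rw [abs_div, abs_of_nonneg (margY_nonneg hp y)]
  refine div_le_one_of_le₀ ?_ (margY_nonneg hp y)
  rw [margY_zmod_two, abs_le]
  constructor <;> linarith [hp (0, y), hp (1, y)]

lemma half_rpow_add_half_rpow (α : ℝ) {u : ℝ} (hu : |u| ≤ 1) :
    ((1 + u) / 2) ^ α + ((1 - u) / 2) ^ α = biasSum α u / 2 ^ α := by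
  obtain ⟨h1, h2⟩ := abs_le.1 hu
  rw [Real.div_rpow (by linarith) zero_le_two, Real.div_rpow (by linarith) zero_le_two, biasSum,
    add_div]

lemma margY_mul_sum_condXY {Y : Type*} {p : ZMod 2 × Y → ℝ} (hp : ∀ xy, 0 ≤ p xy) (α : ℝ)
    (y : Y) :
    margY p y * ∑ x, condXY p x y ^ α = margY p y * biasSum α (condBias p y) / 2 ^ α := by
  by_cases h : margY p y = 0
  · simp [h]
  have e : ∑ x, condXY p x y ^ α = condXY p 0 y ^ α + condXY p 1 y ^ α := Fin.sum_univ_two _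
  have h0 : condXY p 0 y = (1 + condBias p y) / 2 := by
    unfold condXY condBias
    field_simp
    rw [margY_zmod_two]
    ring
  have h1 : condXY p 1 y = (1 - condBias p y) / 2 := by
    unfold condXY condBias
    field_simp
    rw [margY_zmod_two]
    ring
  rw [e, h0, h1, half_rpow_add_half_rpow α (abs_condBias_le_one hp y), mul_div_assoc]

lemma HH_eq {Y : Type*} [Fintype Y] {p : ZMod 2 × Y → ℝ} (hp : ∀ xy, 0 ≤ p xy) (α : ℝ) :
    HH α p = (1 / (1 - α)) *
      Real.log ((∑ y, margY p y * biasSum α (condBias p y)) / 2 ^ α) := by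
  unfold HH
  rw [Finset.sum_congr rfl fun y _ => margY_mul_sum_condXY hp α y, Finset.sum_div]

lemma binEnt_eq (α : ℝ) {a : ℝ} (h0 : 0 ≤ a) (h1 : a ≤ 1 / 2) :
    binEnt α a = (1 / (1 - α)) * Real.log (biasSum α (1 - 2 * a) / 2 ^ α) := by
  rw [← half_rpow_add_half_rpow α (abs_le.2 ⟨by linarith, by linarith⟩), binEnt]
  ring_nf

lemma sum_margY_mul_biasSum_pos {Y : Type*} [Fintype Y] {p : ZMod 2 × Y → ℝ} (hp : IsPMF p)
    (α : ℝ) : 0 < ∑ y, margY p y * biasSum α (condBias p y) := by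
  have hb : ∀ y, 0 < biasSum α (condBias p y) := fun y => by
    rw [← biasSum_abs]
    exact biasSum_pos α (abs_nonneg _) (abs_condBias_le_one hp.1 y)
  have hnn : ∀ y ∈ Finset.univ, 0 ≤ margY p y * biasSum α (condBias p y) := fun y _ =>
    mul_nonneg (margY_nonneg hp.1 y) (hb y).le
  refine (Finset.sum_nonneg hnn).lt_of_ne fun h => ?_
  have hz := (Finset.sum_eq_zero_iff_of_nonneg hnn).1 h.symm
  have hs : ∑ y, margY p y = 0 := Finset.sum_eq_zero fun y hy =>
    (mul_eq_zero.1 (hz y hy)).resolve_right (hb y).ne'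
  linarith [sum_margY hp]

lemma biasSum_eq_of_binEnt_eq_HH {Y : Type*} [Fintype Y] {p : ZMod 2 × Y → ℝ} (hp : IsPMF p)
    {α a : ℝ} (hα1 : α ≠ 1) (ha : a ∈ Set.Icc (0:ℝ) (1/2)) (h : binEnt α a = HH α p) :
    biasSum α (1 - 2 * a) = ∑ y, margY p y * biasSum α (condBias p y) := by
  have h2 : (0:ℝ) < 2 ^ α := Real.rpow_pos_of_pos two_pos α
  rw [binEnt_eq α ha.1 ha.2, HH_eq hp.1] at h
  have h3 := mul_left_cancel₀ (one_div_ne_zero (sub_ne_zero.2 hα1.symm)) h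
  have h4 := Real.log_injOn_pos
    (div_pos (biasSum_pos α (by linarith [ha.2]) (by linarith [ha.1])) h2)
    (div_pos (sum_margY_mul_biasSum_pos hp α) h2) h3
  exact (div_left_inj' h2.ne').1 h4

lemma combinedZ_zero {Y Y' : Type*} (p1 : ZMod 2 × Y → ℝ) (p2 : ZMod 2 × Y' → ℝ) (y : Y × Y') :
    combinedZ p1 p2 (0, y) = p1 (0, y.1) * p2 (0, y.2) + p1 (1, y.1) * p2 (1, y.2) :=
  Fin.sum_univ_two _

lemma combinedZ_one {Y Y' : Type*} (p1 : ZMod 2 × Y → ℝ) (p2 : ZMod 2 × Y' → ℝ) (y : Y × Y') :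
    combinedZ p1 p2 (1, y) = p1 (1, y.1) * p2 (0, y.2) + p1 (0, y.1) * p2 (1, y.2) :=
  Fin.sum_univ_two _

lemma margY_combinedZ {Y Y' : Type*} (p1 : ZMod 2 × Y → ℝ) (p2 : ZMod 2 × Y' → ℝ)
    (y : Y × Y') :
    margY (combinedZ p1 p2) y = margY p1 y.1 * margY p2 y.2 := by
  simp only [margY_zmod_two, combinedZ_zero, combinedZ_one]
  ring

lemma condBias_combinedZ {Y Y' : Type*} (p1 : ZMod 2 × Y → ℝ) (p2 : ZMod 2 × Y' → ℝ)
    (y : Y × Y') :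
    condBias (combinedZ p1 p2) y = condBias p1 y.1 * condBias p2 y.2 := by
  unfold condBias
  rw [margY_combinedZ, combinedZ_zero, combinedZ_one, div_mul_div_comm]
  ring

lemma combinedZ_isPMF {p1 : ZMod 2 × Y1 → ℝ} {p2 : ZMod 2 × Y2 → ℝ} (hp1 : IsPMF p1)
    (hp2 : IsPMF p2) : IsPMF (combinedZ p1 p2) := by
  refine ⟨fun zy => Finset.sum_nonneg fun x _ => mul_nonneg (hp1.1 _) (hp2.1 _), ?_⟩
  rw [Fintype.sum_prod_type_right]
  calc ∑ y, ∑ x, combinedZ p1 p2 (x, y) = ∑ y : Y1 × Y2, margY p1 y.1 * margY p2 y.2 :=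
        Finset.sum_congr rfl fun y _ => margY_combinedZ p1 p2 y
    _ = 1 := by
        rw [Fintype.sum_prod_type, ← Finset.sum_mul_sum, sum_margY hp1, sum_margY hp2, one_mul]

lemma mul_sum_biasSum_combinedZ_le {p1 : ZMod 2 × Y1 → ℝ} {p2 : ZMod 2 × Y2 → ℝ}
    (hp1 : IsPMF p1) (hp2 : IsPMF p2) {c α b1 b2 : ℝ} (hα0 : 0 < α) (hα1 : α ≠ 1)
    (hc : 0 ≤ c * (α - 1) * (α - 1 - 1) * (|α - 1 - 1| - 1))
    (hb1 : b1 ∈ Set.Icc (0:ℝ) 1) (hb2 : b2 ∈ Set.Icc (0:ℝ) 1)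
    (h1 : biasSum α b1 = ∑ y, margY p1 y * biasSum α (condBias p1 y))
    (h2 : biasSum α b2 = ∑ y, margY p2 y * biasSum α (condBias p2 y)) :
    c * (α - 1) * ∑ y, margY (combinedZ p1 p2) y * biasSum α (condBias (combinedZ p1 p2) y)
      ≤ c * (α - 1) * biasSum α (b1 * b2) := by
  have step1 : ∀ y2, margY p2 y2 * (c * (α - 1) *
      ∑ y1, margY p1 y1 * biasSum α (condBias p2 y2 * condBias p1 y1))
      ≤ margY p2 y2 * (c * (α - 1) * biasSum α (condBias p2 y2 * b1)) := fun y2 =>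
    mul_le_mul_of_nonneg_left
      (mul_sum_biasSum_le hα0 hα1 hc (margY_nonneg hp1.1) (sum_margY hp1)
        (abs_condBias_le_one hp1.1) hb1 (abs_condBias_le_one hp2.1 y2) h1)
      (margY_nonneg hp2.1 y2)
  have step2 := mul_sum_biasSum_le hα0 hα1 hc (margY_nonneg hp2.1) (sum_margY hp2)
    (abs_condBias_le_one hp2.1) hb2 (abs_le.2 ⟨by linarith [hb1.1], hb1.2⟩) h2
  refine le_trans ?_ step2
  have hs := Finset.sum_le_sum fun y2 (_ : y2 ∈ Finset.univ) => step1 y2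
  convert hs using 1
  · rw [Fintype.sum_prod_type_right, Finset.mul_sum]
    refine Finset.sum_congr rfl fun y2 _ => ?_
    rw [Finset.mul_sum, Finset.mul_sum, Finset.mul_sum]
    refine Finset.sum_congr rfl fun y1 _ => ?_
    rw [margY_combinedZ, condBias_combinedZ, mul_comm (condBias p2 y2)]
    ring
  · rw [Finset.mul_sum]
    refine Finset.sum_congr rfl fun y2 _ => ?_
    rw [mul_comm b1]
    ring

lemma mul_binEnt_le_mul_HH_combinedZ {p1 : ZMod 2 × Y1 → ℝ} {p2 : ZMod 2 × Y2 → ℝ}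
    (hp1 : IsPMF p1) (hp2 : IsPMF p2) {c α a1 a2 : ℝ} (hα0 : 0 < α) (hα1 : α ≠ 1)
    (hc : 0 ≤ c * (α - 1) * (α - 1 - 1) * (|α - 1 - 1| - 1))
    (ha1 : a1 ∈ Set.Icc (0:ℝ) (1/2)) (ha2 : a2 ∈ Set.Icc (0:ℝ) (1/2))
    (he1 : binEnt α a1 = HH α p1) (he2 : binEnt α a2 = HH α p2) :
    c * binEnt α (a1 * (1 - a2) + a2 * (1 - a1)) ≤ c * HH α (combinedZ p1 p2) := by
  obtain ⟨h10, h11⟩ := ha1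
  obtain ⟨h20, h21⟩ := ha2
  have hb1 : 1 - 2 * a1 ∈ Set.Icc (0:ℝ) 1 := ⟨by linarith, by linarith⟩
  have hb2 : 1 - 2 * a2 ∈ Set.Icc (0:ℝ) 1 := ⟨by linarith, by linarith⟩
  have key := mul_sum_biasSum_combinedZ_le hp1 hp2 hα0 hα1 hc hb1 hb2
    (biasSum_eq_of_binEnt_eq_HH hp1 hα1 ⟨h10, h11⟩ he1)
    (biasSum_eq_of_binEnt_eq_HH hp2 hα1 ⟨h20, h21⟩ he2)
  have hq := combinedZ_isPMF hp1 hp2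
  have hS := sum_margY_mul_biasSum_pos hq α
  have hB := biasSum_pos α (mul_nonneg hb1.1 hb2.1) (mul_le_one₀ hb1.2 hb2.1 hb2.2)
  have e : 1 - 2 * (a1 * (1 - a2) + a2 * (1 - a1)) = (1 - 2 * a1) * (1 - 2 * a2) := by ring
  rw [binEnt_eq α (by nlinarith) (by nlinarith), HH_eq hq.1, e]
  set S := ∑ y, margY (combinedZ p1 p2) y * biasSum α (condBias (combinedZ p1 p2) y)
  set B := biasSum α ((1 - 2 * a1) * (1 - 2 * a2))
  have h2 : (0:ℝ) < 2 ^ α := Real.rpow_pos_of_pos two_pos α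
  rw [Real.log_div hS.ne' h2.ne', Real.log_div hB.ne' h2.ne']
  have hlog : c * (α - 1) * Real.log S ≤ c * (α - 1) * Real.log B := by
    rcases lt_trichotomy (c * (α - 1)) 0 with h | h | h
    · exact (mul_le_mul_left_of_neg h).2 (Real.log_le_log hB ((mul_le_mul_left_of_neg h).1 key))
    · simp [h]
    · exact (mul_le_mul_iff_right₀ h).2 (Real.log_le_log hS ((mul_le_mul_iff_right₀ h).1 key))
  have hne : 1 - α ≠ 0 := sub_ne_zero.2 hα1.symm
  have hfin : 0 ≤ (c * (α - 1) * Real.log B - c * (α - 1) * Real.log S) / (1 - α) ^ 2 :=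
    div_nonneg (sub_nonneg.2 hlog) (sq_nonneg _)
  rw [← sub_nonneg]
  refine hfin.trans_eq ?_
  field_simp
  ring

/-- **Hayashi BSC bound for the check node.** -/
theorem hayashi_bsc_bound
    (p1 : ZMod 2 × Y1 → ℝ) (p2 : ZMod 2 × Y2 → ℝ) (hp1 : IsPMF p1) (hp2 : IsPMF p2)
    (α : ℝ) (hα0 : 0 < α)
    (a1 a2 : ℝ) (ha1 : a1 ∈ Set.Icc (0:ℝ) (1/2)) (ha2 : a2 ∈ Set.Icc (0:ℝ) (1/2))
    (he1 : binEnt α a1 = HH α p1) (he2 : binEnt α a2 = HH α p2) :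
    (α ∈ Set.Ioo (0:ℝ) 1 ∪ Set.Ioc (1:ℝ) 2 ∪ Set.Ici (3:ℝ) →
      HH α (combinedZ p1 p2) ≥ binEnt α (a1 * (1 - a2) + a2 * (1 - a1))) ∧
    (α ∈ Set.Icc (2:ℝ) 3 →
      HH α (combinedZ p1 p2) ≤ binEnt α (a1 * (1 - a2) + a2 * (1 - a1))) ∧
    (α = 2 ∨ α = 3 →
      HH α (combinedZ p1 p2) = binEnt α (a1 * (1 - a2) + a2 * (1 - a1))) := by
  have lower : α ∈ Set.Ioo (0:ℝ) 1 ∪ Set.Ioc (1:ℝ) 2 ∪ Set.Ici (3:ℝ) →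
      HH α (combinedZ p1 p2) ≥ binEnt α (a1 * (1 - a2) + a2 * (1 - a1)) := by
    intro h
    have hα1 : α ≠ 1 := by
      rintro rfl
      norm_num at h
    have hc : 0 ≤ 1 * (α - 1) * (α - 1 - 1) * (|α - 1 - 1| - 1) := by
      rcases le_total α 2 with hα2 | hα2
      · rw [abs_of_nonpos (by linarith)]
        nlinarith [mul_nonneg (sq_nonneg (α - 1)) (sub_nonneg.2 hα2)]
      · rw [abs_of_nonneg (by linarith)]
        rcases h with (h | h) | h
        · linarith [h.2]
        · rw [le_antisymm h.2 hα2]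
          norm_num
        · rw [Set.mem_Ici] at h
          exact mul_nonneg (mul_nonneg (by linarith) (by linarith)) (by linarith)
    simpa using mul_binEnt_le_mul_HH_combinedZ hp1 hp2 hα0 hα1 hc ha1 ha2 he1 he2
  have upper : α ∈ Set.Icc (2:ℝ) 3 →
      HH α (combinedZ p1 p2) ≤ binEnt α (a1 * (1 - a2) + a2 * (1 - a1)) := by
    intro h
    have hc : 0 ≤ (-1) * (α - 1) * (α - 1 - 1) * (|α - 1 - 1| - 1) := by
      rw [abs_of_nonneg (by linarith [h.1])]
      have := mul_nonneg (mul_nonneg (sub_nonneg.2 (one_le_two.trans h.1))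
        (sub_nonneg.2 h.1)) (sub_nonneg.2 h.2)
      linarith
    have := mul_binEnt_le_mul_HH_combinedZ hp1 hp2 hα0 (by linarith [h.1] : (1:ℝ) < α).ne' hc
      ha1 ha2 he1 he2
    linarith
  refine ⟨lower, upper, fun h => le_antisymm (upper ?_) (lower ?_)⟩ <;>
    rcases h with rfl | rfl <;> norm_num
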